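/- Φ(e_k ∘ h₂) = k + 1 for every k ≥ 1, where Φ(f) is the maximum first part among partitions appearing in the Schur expansion of f. -/

import Mathlib

open MvPolynomial Finset

/-- The ring of symmetric functions (with rational coefficients), realized as the free
commutative `ℚ`-algebra on the complete homogeneous symmetric functions `h₁, h₂, …`,
where the variable `n : ℕ` corresponds to `h_{n+1}`. -/
abbrev SymFn : Type := MvPolynomial ℕ ℚ

/-- The complete homogeneous symmetric function `h_n`, with `h_n = 0` for `n < 0`
and `h_0 = 1`. -/
noncomputable def hh (n : ℤ) : SymFn :=
  if n < 0 then 0 else if n = 0 then 1 else MvPolynomial.X (n.toNat - 1)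

/-- The power sum symmetric functions, defined from the `h`'s by Newton's identities:
`p_k = k h_k - ∑_{i=1}^{k-1} h_i p_{k-i}`. -/
noncomputable def pp : ℕ → SymFn
  | 0 => 0
  | (k+1) => ((k : ℚ) + 1) • hh (k+1) - ∑ i ∈ Finset.range k, hh (i+1) * pp (k - i)
  decreasing_by exact Nat.lt_succ_of_le (Nat.sub_le _ _)

/-- `h_m` written as a polynomial in the power sums (the variable `j` stands for `p_{j+1}`),
via the recursion `m h_m = ∑_{i=1}^{m} p_i h_{m-i}`. -/
noncomputable def hInP : ℕ → MvPolynomial ℕ ℚ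
  | 0 => 1
  | (m+1) => ((m : ℚ) + 1)⁻¹ •
      ∑ i ∈ Finset.range (m+1), MvPolynomial.X i * hInP (m - i)
  decreasing_by exact Nat.lt_succ_of_le (Nat.sub_le _ _)

/-- The `k`-th Adams operation: the algebra endomorphism of `SymFn` determined by
`p_m ↦ p_{k m}` on power sums. -/
noncomputable def adams (k : ℕ) : SymFn →ₐ[ℚ] SymFn :=
  aeval fun m => (aeval fun j => pp (k * (j+1))) (hInP (m+1))

/-- The plethysm `h_k ∘ g`, via the recursion
`k (h_k ∘ g) = ∑_{i=1}^{k} (p_i ∘ g) (h_{k-i} ∘ g)`, where `p_i ∘ g = adams i g`. -/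
noncomputable def hPleth (g : SymFn) : ℕ → SymFn
  | 0 => 1
  | (k+1) => ((k : ℚ) + 1)⁻¹ •
      ∑ i ∈ Finset.range (k+1), adams (i+1) g * hPleth g (k - i)
  decreasing_by exact Nat.lt_succ_of_le (Nat.sub_le _ _)

/-- The (outer) plethysm `f ∘ g` of symmetric functions: the algebra homomorphism
in the left argument sending `h_k ↦ h_k ∘ g`. -/
noncomputable def pleth (f g : SymFn) : SymFn := aeval (fun m => hPleth g (m+1)) f

/-- The elementary symmetric functions, via `e_k = ∑_{i=1}^{k} (-1)^{i-1} h_i e_{k-i}`. -/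
noncomputable def ee : ℕ → SymFn
  | 0 => 1
  | (k+1) => ∑ i ∈ Finset.range (k+1), ((-1 : ℚ))^i • (hh (i+1) * ee (k - i))
  decreasing_by exact Nat.lt_succ_of_le (Nat.sub_le _ _)

/-- The parts of a multiset, as a weakly decreasing list. -/
def sortedParts (m : Multiset ℕ) : List ℕ := (m.sort (· ≤ ·)).reverse

/-- The Schur function `s_m`, via the Jacobi–Trudi determinant
`s_λ = det (h_{λ_i + j - i})`. -/
noncomputable def schur (m : Multiset ℕ) : SymFn :=
  Matrix.det (Matrix.of fun i j : Fin (Multiset.card m) =>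
    hh (((sortedParts m).getD i 0 : ℤ) + (j : ℤ) - (i : ℤ)))

/-- A multiset of naturals is a partition when all its parts are positive. -/
def IsPartition (m : Multiset ℕ) : Prop := 0 ∉ m

/-- A strict partition: positive, pairwise distinct parts. -/
def IsStrictPartition (m : Multiset ℕ) : Prop := 0 ∉ m ∧ m.Nodup

/-- The first (largest) part `λ₁` of a partition. -/
def firstPart (m : Multiset ℕ) : ℕ := m.sup

/-- The size `|λ|` of a partition. -/
def psize (m : Multiset ℕ) : ℕ := m.sum

/-- The conjugate (transposed) partition. -/
def conj (m : Multiset ℕ) : Multiset ℕ :=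
  ((List.range m.sup).map fun i => Multiset.card (m.filter fun x => i < x) : List ℕ)

/-- The partition `ν[N] = (N - |ν|, ν₁, ν₂, …)` (valid when `N ≥ |ν| + ν₁`). -/
def padded (ν : Multiset ℕ) (N : ℕ) : Multiset ℕ := (N - ν.sum) ::ₘ ν

/-- `c` is the expansion of `f` in the basis of Schur functions indexed by partitions. -/
def SchurExpansion (f : SymFn) (c : Multiset ℕ →₀ ℚ) : Prop :=
  (∀ κ ∈ c.support, IsPartition κ) ∧ f = c.sum fun κ a => a • schur κ

/-- `Φ` of a Schur expansion: the largest first part of a partition occurring in it. -/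
def Phi (c : Multiset ℕ →₀ ℚ) : ℕ := c.support.sup firstPart

/-- The partition `2α`, doubling every part. -/
def double (m : Multiset ℕ) : Multiset ℕ := m.map (2 * ·)

/-- For a strict partition `β = (β₁ > β₂ > … > β_r > 0)`, the partition `Γ(β)` with
Frobenius coordinates `(β₁ - 1, …, β_r - 1 | β₁, …, β_r)`. -/
def gammaFrob (β : Multiset ℕ) : Multiset ℕ :=
  let b := sortedParts β
  let r := b.length
  (((List.range r).map fun i => b.getD i 0 + i)
    ++ ((List.range (b.getD 0 0 + 1 - r)).map fun t =>
        ((List.range r).filter fun j => r + t ≤ b.getD j 0 + j).length) : List ℕ)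


/-! ### The shift `f[X] ↦ f[X + t]` -/

/-- The algebra map `f[X] ↦ f[X+t]`. -/
noncomputable def shiftE : SymFn →ₐ[ℚ] Polynomial SymFn :=
  aeval fun m : ℕ => ∑ i ∈ Finset.range (m+2),
    Polynomial.monomial i (hh ((m : ℤ) + 1 - (i : ℤ)))

lemma hh_neg {n : ℤ} (h : n < 0) : hh n = 0 := by simp [hh, h]

lemma hh_zero : hh 0 = 1 := by simp [hh]

lemma hh_succ (n : ℕ) : hh ((n : ℤ) + 1) = MvPolynomial.X n := by
  have h1 : ¬ ((n : ℤ) + 1 < 0) := by omega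
  have h2 : ¬ ((n : ℤ) + 1 = 0) := by omega
  have h3 : ((n : ℤ) + 1).toNat - 1 = n := by omega
  simp only [hh, h1, h2, h3, if_false]

lemma coeff_shiftE_hh (n : ℤ) (j : ℕ) : (shiftE (hh n)).coeff j = hh (n - j) := by
  rcases lt_trichotomy n 0 with h | h | h
  · rw [hh_neg h, hh_neg (by omega)]; simp
  · subst h
    rw [hh_zero, map_one, Polynomial.coeff_one]
    split_ifs with h
    · subst h; simp [hh_zero]
    · rw [hh_neg (by omega)]
  · obtain ⟨m, rfl⟩ : ∃ m : ℕ, n = (m : ℤ) + 1 := ⟨(n - 1).toNat, by omega⟩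
    rw [hh_succ, shiftE, aeval_X, Polynomial.finsetSum_coeff]
    simp only [Polynomial.coeff_monomial]
    rw [Finset.sum_ite_eq']
    split_ifs with h
    · rfl
    · rw [hh_neg]; simp at h; omega

lemma shiftE_hh_rec (n : ℤ) :
    shiftE (hh n) = Polynomial.C (hh n) + Polynomial.X * shiftE (hh (n - 1)) := by
  ext1 j
  cases j with
  | zero => simp [coeff_shiftE_hh]
  | succ j =>
    simp only [coeff_shiftE_hh, Polynomial.coeff_add, Polynomial.coeff_C_succ,
      Polynomial.coeff_X_mul]
    rw [zero_add]; congr 1; push_cast; ring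

/-! ### Jacobi–Trudi determinants under the shift -/

/-- Jacobi–Trudi determinant of a sequence. -/
noncomputable def jt (n : ℕ) (f : ℕ → ℕ) : SymFn :=
  Matrix.det (Matrix.of fun i j : Fin n => hh ((f i : ℤ) + (j : ℤ) - (i : ℤ)))

lemma shiftE_jt (n : ℕ) (f : ℕ → ℕ) : ∃ d : Fin (n+1) → SymFn,
    d 0 = jt n (fun i => f (i+1)) ∧
    shiftE (jt (n+1) f) = ∑ i : Fin (n+1),
      shiftE (hh ((f i : ℤ) - (i : ℤ))) * Polynomial.C (d i) := by
  let A : Matrix (Fin (n+1)) (Fin (n+1)) (Polynomial SymFn) :=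
    Matrix.of fun i j => shiftE (hh ((f i : ℤ) + (j : ℤ) - (i : ℤ)))
  let B : Matrix (Fin (n+1)) (Fin (n+1)) (Polynomial SymFn) :=
    Matrix.of fun i j => if j = 0 then shiftE (hh ((f i : ℤ) - (i : ℤ))) else
      Polynomial.C (hh ((f i : ℤ) + (j : ℤ) - (i : ℤ)))
  have hA : shiftE (jt (n+1) f) = A.det := by
    rw [jt, AlgHom.map_det]; rfl
  have hAB : A.det = B.det := by
    apply Matrix.det_eq_of_forall_col_eq_smul_add_pred (fun _ => Polynomial.X)
    · intro i; simp [A, B]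
    · intro i j
      simp only [A, B, Matrix.of_apply, Fin.succ_ne_zero, if_false]
      rw [shiftE_hh_rec]
      congr 4
      simp only [Fin.val_succ, Fin.val_castSucc]; push_cast; ring
  let N : Fin (n+1) → Matrix (Fin n) (Fin n) SymFn := fun i =>
    Matrix.of fun a b => hh ((f (i.succAbove a) : ℤ) + (b.succ : Fin (n+1)).val
      - ((i.succAbove a : Fin (n+1)).val : ℤ))
  refine ⟨fun i => (-1) ^ (i : ℕ) * (N i).det, ?_, ?_⟩
  · simp only [Fin.val_zero, pow_zero, one_mul, jt]
    congr 1
    ext1 a b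
    simp only [N, Matrix.of_apply, Fin.succAbove_zero, Fin.val_succ]
    congr 1; push_cast; ring
  · rw [hA, hAB, Matrix.det_succ_column_zero]
    refine Finset.sum_congr rfl fun i _ => ?_
    have : (B.submatrix i.succAbove Fin.succ).det = Polynomial.C (N i).det := by
      rw [RingHom.map_det]; congr 1
    rw [this]
    simp only [B, Matrix.of_apply, if_true, map_mul, map_pow, map_neg, map_one]
    ring

lemma coeff_shiftE_jt_gt (n : ℕ) (f : ℕ → ℕ) (hf : ∀ i, f i ≤ f 0) (j : ℕ) (hj : f 0 < j) :
    (shiftE (jt (n+1) f)).coeff j = 0 := by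
  obtain ⟨d, -, h⟩ := shiftE_jt n f
  rw [h, Polynomial.finsetSum_coeff]
  refine Finset.sum_eq_zero fun i _ => ?_
  have := hf i
  rw [Polynomial.coeff_mul_C, coeff_shiftE_hh, hh_neg (by omega), zero_mul]

lemma coeff_shiftE_jt_eq (n : ℕ) (f : ℕ → ℕ) (hf : ∀ i, f i ≤ f 0) :
    (shiftE (jt (n+1) f)).coeff (f 0) = jt n (fun i => f (i+1)) := by
  obtain ⟨d, hd, h⟩ := shiftE_jt n f
  rw [h, Polynomial.finsetSum_coeff, Fin.sum_univ_succ, Finset.sum_eq_zero]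
  · rw [Polynomial.coeff_mul_C, coeff_shiftE_hh, hd]; simp [hh_zero]
  · intro i _
    have := hf i.succ
    rw [Polynomial.coeff_mul_C, coeff_shiftE_hh, hh_neg, zero_mul]
    rw [Fin.val_succ] at *; push_cast; omega

/-! ### Schur functions under the shift -/

lemma sortedParts_coe (m : Multiset ℕ) : ((sortedParts m : List ℕ) : Multiset ℕ) = m := by
  rw [sortedParts, Multiset.coe_reverse, Multiset.sort_eq]

lemma sortedParts_pairwise (m : Multiset ℕ) : (sortedParts m).Pairwise (fun a b => b ≤ a) := by
  rw [sortedParts, List.pairwise_reverse]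
  exact Multiset.pairwise_sort m (· ≤ ·)

lemma sortedParts_eq {m : Multiset ℕ} {l : List ℕ} (h : (l : Multiset ℕ) = m)
    (hl : l.Pairwise (fun a b => b ≤ a)) : sortedParts m = l := by
  have hp : (sortedParts m).Perm l := by
    rw [← Multiset.coe_eq_coe, sortedParts_coe, h]
  exact hp.eq_of_pairwise (fun a b _ _ h1 h2 => le_antisymm h2 h1) (sortedParts_pairwise m) hl

/-- Remove the first part. -/
def tailP (m : Multiset ℕ) : Multiset ℕ := m.erase m.sup

lemma sortedParts_cons {m : Multiset ℕ} (hm : m ≠ 0) :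
    m = m.sup ::ₘ tailP m ∧ sortedParts m = m.sup :: sortedParts (tailP m) := by
  obtain ⟨x, xs, hx⟩ : ∃ x xs, sortedParts m = x :: xs := by
    cases h : sortedParts m with
    | nil => exact absurd (by rw [← sortedParts_coe m, h]; rfl) hm
    | cons x xs => exact ⟨x, xs, rfl⟩
  have hp := sortedParts_pairwise m
  rw [hx, List.pairwise_cons] at hp
  have hme : m = x ::ₘ (xs : Multiset ℕ) := by
    conv_lhs => rw [← sortedParts_coe m, hx]
    rfl
  have hsup : m.sup = x := by
    rw [hme, Multiset.sup_cons]
    apply sup_eq_left.mpr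
    rw [Multiset.sup_le]
    intro b hb
    exact hp.1 b (by simpa using hb)
  have ht : tailP m = (xs : Multiset ℕ) := by
    rw [tailP, hsup, hme, Multiset.erase_cons_head]
  refine ⟨by rw [hsup, ht]; exact hme, ?_⟩
  rw [hx, hsup, sortedParts_eq ht.symm hp.2]

lemma schur_eq_jt (m : Multiset ℕ) :
    schur m = jt (Multiset.card m) (fun i => (sortedParts m).getD i 0) := rfl

lemma getD_le_sup (m : Multiset ℕ) (i : ℕ) : (sortedParts m).getD i 0 ≤ m.sup := by
  by_cases h : i < (sortedParts m).length
  · rw [List.getD_eq_getElem _ _ h]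
    apply Multiset.le_sup
    have h' : (sortedParts m)[i] ∈ (sortedParts m : Multiset ℕ) :=
      Multiset.mem_coe.mpr (List.getElem_mem h)
    rwa [sortedParts_coe] at h'
  · rw [List.getD_eq_default _ _ (by omega)]; exact Nat.zero_le _

lemma schur_zero : schur 0 = 1 := by
  rw [schur_eq_jt, jt]
  exact Matrix.det_fin_zero

lemma coeff_shiftE_schur_gt (m : Multiset ℕ) (j : ℕ) (hj : m.sup < j) :
    (shiftE (schur m)).coeff j = 0 := by
  by_cases hm : m = 0
  · subst hm
    rw [schur_zero, map_one, Polynomial.coeff_one, if_neg]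
    rintro rfl; simp at hj
  · obtain ⟨h1, h2⟩ := sortedParts_cons hm
    have hc : Multiset.card m = Multiset.card (tailP m) + 1 := by
      conv_lhs => rw [h1, Multiset.card_cons]
    have h0 : (sortedParts m).getD 0 0 = m.sup := by rw [h2]; rfl
    rw [schur_eq_jt, hc]
    apply coeff_shiftE_jt_gt
    · intro i; rw [h0]; exact getD_le_sup m i
    · rw [h0]; exact hj

lemma coeff_shiftE_schur_eq (m : Multiset ℕ) :
    (shiftE (schur m)).coeff m.sup = schur (tailP m) := by
  by_cases hm : m = 0
  · subst hm
    simp [schur_zero, tailP]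
  · obtain ⟨h1, h2⟩ := sortedParts_cons hm
    have hc : Multiset.card m = Multiset.card (tailP m) + 1 := by
      conv_lhs => rw [h1, Multiset.card_cons]
    have h0 : (sortedParts m).getD 0 0 = m.sup := by rw [h2]; rfl
    have := coeff_shiftE_jt_eq (Multiset.card (tailP m)) (fun i => (sortedParts m).getD i 0)
      (by intro i; rw [h0]; exact getD_le_sup m i)
    rw [h0] at this
    rw [schur_eq_jt, hc, this, schur_eq_jt]
    congr 1
    funext i
    rw [h2]; rfl

lemma coeff_shiftE_sum (s : Finset (Multiset ℕ)) (a : Multiset ℕ → ℚ) (M : ℕ)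
    (hM : ∀ κ ∈ s, κ.sup ≤ M) :
    (shiftE (∑ κ ∈ s, a κ • schur κ)).coeff M
      = ∑ κ ∈ s with κ.sup = M, a κ • schur (tailP κ) := by
  rw [map_sum, Polynomial.finsetSum_coeff, Finset.sum_filter]
  refine Finset.sum_congr rfl fun κ hκ => ?_
  rw [map_smul, Polynomial.coeff_smul]
  split_ifs with h
  · rw [← h, coeff_shiftE_schur_eq]
  · rw [coeff_shiftE_schur_gt, smul_zero]
    exact lt_of_le_of_ne (hM κ hκ) h

lemma eq_cons_tail {κ : Multiset ℕ} (h : κ.sup ≠ 0) : κ = κ.sup ::ₘ tailP κ := by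
  apply (sortedParts_cons _).1
  rintro rfl; simp at h

lemma eq_zero_of_sup {κ : Multiset ℕ} (hp : IsPartition κ) (h : κ.sup = 0) : κ = 0 := by
  by_contra hne
  apply hp
  rw [(sortedParts_cons hne).1, h]
  exact Multiset.mem_cons_self _ _

lemma tail_isPartition {κ : Multiset ℕ} (hp : IsPartition κ) : IsPartition (tailP κ) :=
  fun h => hp (Multiset.mem_of_mem_erase h)

lemma schur_indep (N : ℕ) : ∀ (s : Finset (Multiset ℕ)) (a : Multiset ℕ → ℚ),
    (∀ κ ∈ s, IsPartition κ ∧ κ.sum < N) → ∑ κ ∈ s, a κ • schur κ = 0 → ∀ κ ∈ s, a κ = 0 := by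
  induction N with
  | zero => intro s a h _ κ hκ; exact absurd (h κ hκ).2 (by omega)
  | succ N ih =>
    intro s a hs h0
    by_contra! hne
    obtain ⟨κ₁, hκ₁, hne⟩ := hne
    set s₁ := s.filter (fun κ => a κ ≠ 0) with hs₁
    have h1 : ∑ κ ∈ s₁, a κ • schur κ = 0 := by
      rw [hs₁, Finset.sum_filter_of_ne, h0]
      intro κ _ h h'; apply h; rw [h', zero_smul]
    obtain ⟨κ₀, hκ₀, hmax⟩ := Finset.exists_max_image s₁ (fun κ => κ.sup)
      ⟨κ₁, by simp [hs₁, hκ₁, hne]⟩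
    have hκ₀s : κ₀ ∈ s ∧ a κ₀ ≠ 0 := by simpa [hs₁] using hκ₀
    have h2 := coeff_shiftE_sum s₁ a κ₀.sup hmax
    rw [h1, map_zero, Polynomial.coeff_zero] at h2
    have hpart : ∀ κ ∈ s₁, IsPartition κ ∧ κ.sum < N + 1 := fun κ h =>
      hs κ (Finset.mem_filter.mp h).1
    by_cases hM : κ₀.sup = 0
    · have : s₁.filter (fun κ => κ.sup = κ₀.sup) = {κ₀} := by
        ext κ
        simp only [Finset.mem_filter, Finset.mem_singleton]
        constructor
        · rintro ⟨h, h'⟩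
          rw [eq_zero_of_sup (hpart κ h).1 (h'.trans hM), eq_zero_of_sup (hpart κ₀ hκ₀).1 hM]
        · rintro rfl; exact ⟨hκ₀, rfl⟩
      rw [this, Finset.sum_singleton, eq_zero_of_sup (hpart κ₀ hκ₀).1 hM] at h2
      have ht : tailP 0 = 0 := rfl
      rw [ht, schur_zero] at h2
      have h3 := (smul_eq_zero.mp h2.symm).resolve_right one_ne_zero
      rw [eq_zero_of_sup (hpart κ₀ hκ₀).1 hM] at hκ₀s
      exact hκ₀s.2 h3
    · have hinj : ∀ κ ∈ s₁.filter (fun κ => κ.sup = κ₀.sup), κ = κ₀.sup ::ₘ tailP κ := by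
        intro κ h
        have h' := (Finset.mem_filter.mp h).2
        conv_lhs => rw [eq_cons_tail (κ := κ) (by rw [h']; exact hM), h']
      have h3 := ih ((s₁.filter (fun κ => κ.sup = κ₀.sup)).image tailP)
        (fun ν => a (κ₀.sup ::ₘ ν)) ?_ ?_ (tailP κ₀) ?_
      · simp only [← eq_cons_tail hM] at h3
        exact hκ₀s.2 h3
      · intro ν hν
        obtain ⟨κ, hκ, rfl⟩ := Finset.mem_image.mp hν
        have hκ' := hpart κ (Finset.mem_filter.mp hκ).1
        refine ⟨tail_isPartition hκ'.1, ?_⟩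
        have := congrArg Multiset.sum (hinj κ hκ)
        rw [Multiset.sum_cons] at this
        omega
      · rw [Finset.sum_image]
        · rw [h2]
          refine Finset.sum_congr rfl fun κ hκ => ?_
          rw [← hinj κ hκ]
        · intro x hx y hy hxy
          rw [hinj x hx, hinj y hy, hxy]
      · exact Finset.mem_image_of_mem _ (Finset.mem_filter.mpr ⟨hκ₀, rfl⟩)

lemma phi_of_shift (f : SymFn) (c : Multiset ℕ →₀ ℚ) (hc : SchurExpansion f c) (d : ℕ)
    (hd : (shiftE f).coeff d ≠ 0) (hd' : ∀ j, d < j → (shiftE f).coeff j = 0) :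
    Phi c = d := by
  obtain ⟨hp, hf⟩ := hc
  have hf' : f = ∑ κ ∈ c.support, c κ • schur κ := hf
  have hle : ∀ κ ∈ c.support, κ.sup ≤ Phi c := fun κ hκ => Finset.le_sup (f := firstPart) hκ
  apply le_antisymm
  · by_contra! hlt
    have h0 := hd' _ hlt
    rw [hf', coeff_shiftE_sum _ _ _ hle] at h0
    have hne : c.support.Nonempty := by
      by_contra h
      rw [Finset.not_nonempty_iff_eq_empty] at h
      rw [Phi, h] at hlt; simp at hlt
    obtain ⟨κ₀, hκ₀, hM⟩ := Finset.exists_mem_eq_sup c.support hne firstPart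
    change Phi c = κ₀.sup at hM
    have hM0 : κ₀.sup ≠ 0 := by omega
    have hinj : ∀ κ ∈ c.support.filter (fun κ => κ.sup = Phi c), κ = κ₀.sup ::ₘ tailP κ := by
      intro κ h
      have h' := (Finset.mem_filter.mp h).2
      rw [hM] at h'
      conv_lhs => rw [eq_cons_tail (κ := κ) (by rw [h']; exact hM0), h']
    have h3 := schur_indep
      ((((c.support.filter (fun κ => κ.sup = Phi c)).image tailP).sup Multiset.sum) + 1)
      ((c.support.filter (fun κ => κ.sup = Phi c)).image tailP)
      (fun ν => c (κ₀.sup ::ₘ ν)) ?_ ?_ (tailP κ₀) ?_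
    · simp only [← eq_cons_tail hM0] at h3
      exact (Finsupp.mem_support_iff.mp hκ₀) h3
    · intro ν hν
      refine ⟨?_, Nat.lt_succ_of_le (Finset.le_sup (f := Multiset.sum) hν)⟩
      obtain ⟨κ, hκ, rfl⟩ := Finset.mem_image.mp hν
      exact tail_isPartition (hp κ (Finset.mem_filter.mp hκ).1)
    · rw [Finset.sum_image]
      · rw [← h0]
        refine Finset.sum_congr rfl fun κ hκ => ?_
        rw [← hinj κ hκ]
      · intro x hx y hy hxy
        rw [hinj x hx, hinj y hy, hxy]
    · exact Finset.mem_image_of_mem _ (Finset.mem_filter.mpr ⟨hκ₀, hM.symm⟩)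
  · by_contra! hlt
    apply hd
    rw [hf', coeff_shiftE_sum _ _ _ (fun κ hκ => (hle κ hκ).trans hlt.le), Finset.sum_eq_zero]
    intro κ hκ
    have := Finset.mem_filter.mp hκ
    have := hle κ this.1
    omega

/-! ### Generating functions -/

section genfun

variable {R : Type*} [CommRing R]

/-- The Euler operator `u d/du` on power series. -/
noncomputable def euler (F : PowerSeries R) : PowerSeries R :=
  PowerSeries.X * PowerSeries.derivative R F

lemma coeff_euler (F : PowerSeries R) (n : ℕ) :
    PowerSeries.coeff n (euler F) = (n : R) * PowerSeries.coeff n F := by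
  cases n with
  | zero => simp [euler]
  | succ n =>
    rw [euler, PowerSeries.coeff_succ_X_mul, PowerSeries.coeff_derivative]
    push_cast; ring

lemma euler_mul (F G : PowerSeries R) : euler (F * G) = euler F * G + F * euler G := by
  simp only [euler, Derivation.leibniz, smul_eq_mul]; ring

lemma euler_one_sub (a : R) :
    euler (1 - PowerSeries.C a * PowerSeries.X) = - (PowerSeries.C a * PowerSeries.X) := by
  simp only [euler, map_sub, PowerSeries.derivative_one, Derivation.leibniz,
    PowerSeries.derivative_C, PowerSeries.derivative_X, smul_eq_mul]
  ring

lemma euler_map {S : Type*} [CommRing S] (φ : R →+* S) (F : PowerSeries R) :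
    euler (PowerSeries.map φ F) = PowerSeries.map φ (euler F) := by
  ext n; simp [coeff_euler]

lemma euler_rescale (a : R) (F : PowerSeries R) :
    euler (PowerSeries.rescale a F) = PowerSeries.rescale a (euler F) := by
  ext n; simp only [coeff_euler, PowerSeries.coeff_rescale]; ring

lemma euler_unique [IsDomain R] [CharZero R] (Q F G : PowerSeries R)
    (hQ : PowerSeries.coeff 0 Q = 0)
    (hF : euler F = Q * F) (hG : euler G = Q * G)
    (h0 : PowerSeries.coeff 0 F = PowerSeries.coeff 0 G) : F = G := by
  ext n
  induction n using Nat.strong_induction_on with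
  | _ n ih =>
    cases n with
    | zero => exact h0
    | succ n =>
      have h1 := congrArg (PowerSeries.coeff (n+1)) hF
      have h2 := congrArg (PowerSeries.coeff (n+1)) hG
      rw [coeff_euler, PowerSeries.coeff_mul] at h1 h2
      have h3 : ((n+1 : ℕ) : R) * PowerSeries.coeff (n+1) F
          = ((n+1 : ℕ) : R) * PowerSeries.coeff (n+1) G := by
        rw [h1, h2]
        refine Finset.sum_congr rfl fun p hp => ?_
        rw [Finset.HasAntidiagonal.mem_antidiagonal] at hp
        by_cases hp0 : p.1 = 0
        · rw [hp0, hQ, zero_mul, zero_mul]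
        · rw [ih p.2 (by omega)]
      exact mul_left_cancel₀ (Nat.cast_ne_zero.mpr (Nat.succ_ne_zero n)) h3

lemma euler_of_rec (q H : ℕ → R) (hq : q 0 = 0)
    (h : ∀ n : ℕ, ((n : R) + 1) * H (n+1) = ∑ i ∈ Finset.range (n+1), q (i+1) * H (n - i)) :
    euler (PowerSeries.mk H) = PowerSeries.mk q * PowerSeries.mk H := by
  ext n
  rw [coeff_euler, PowerSeries.coeff_mul]
  simp only [PowerSeries.coeff_mk]
  rw [Finset.Nat.sum_antidiagonal_eq_sum_range_succ (fun i j => q i * H j),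
    Finset.sum_range_succ', hq, zero_mul, add_zero]
  cases n with
  | zero => simp
  | succ n =>
    push_cast; rw [h]

lemma inv_of_rec (H e : ℕ → R) (hH : H 0 = 1) (he : e 0 = 1)
    (h : ∀ n : ℕ, e (n+1) = ∑ i ∈ Finset.range (n+1), (-1) ^ i * (H (i+1) * e (n - i))) :
    PowerSeries.mk H * PowerSeries.mk (fun n => (-1) ^ n * e n) = 1 := by
  ext n
  rw [PowerSeries.coeff_mul]
  simp only [PowerSeries.coeff_mk]
  rw [Finset.Nat.sum_antidiagonal_eq_sum_range_succ (fun i j => H i * ((-1) ^ j * e j)),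
    Finset.sum_range_succ', hH, PowerSeries.coeff_one]
  cases n with
  | zero => simp [he]
  | succ n =>
    rw [Nat.sub_zero, h, if_neg (Nat.succ_ne_zero n), one_mul, Finset.mul_sum,
      ← Finset.sum_add_distrib]
    refine Finset.sum_eq_zero fun i hi => ?_
    have hi' : i < n + 1 := Finset.mem_range.mp hi
    obtain ⟨d, rfl⟩ : ∃ d, n = i + d := ⟨n - i, by omega⟩
    have e1 : i + d + 1 - (i + 1) = d := by omega
    have e2 : i + d - i = d := by omega
    rw [e1, e2]
    have e3 : ((-1 : R)) ^ i * (-1) ^ i = 1 := by rw [← mul_pow]; simp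
    have : ((-1 : R)) ^ (i + d + 1) * ((-1) ^ i * (H (i+1) * e d))
      = - (((-1) ^ i * (-1) ^ i) * (-1) ^ d * (H (i+1) * e d)) := by ring
    rw [this, e3]; ring

/-- The series `∑_{n ≥ 1} aⁿ uⁿ`. -/
noncomputable def geom (a : R) : PowerSeries R :=
  PowerSeries.mk fun n => if n = 0 then 0 else a ^ n

lemma geom_mul (a : R) :
    geom a * (1 - PowerSeries.C a * PowerSeries.X) = PowerSeries.C a * PowerSeries.X := by
  ext n
  rw [mul_sub, mul_one, map_sub,
    show geom a * (PowerSeries.C a * PowerSeries.X)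
      = PowerSeries.C a * (geom a * PowerSeries.X) by ring, PowerSeries.coeff_C_mul,
    PowerSeries.coeff_C_mul]
  rcases n with _ | _ | n
  · simp [geom]
  · rw [PowerSeries.coeff_succ_mul_X]; simp [geom]
  · rw [PowerSeries.coeff_succ_mul_X, PowerSeries.coeff_X, if_neg (by omega)]
    simp [geom]; ring

end genfun

lemma smul_cancel_succ (k : ℕ) (x : SymFn) :
    ((k : SymFn) + 1) * (((k : ℚ) + 1)⁻¹ • x) = x := by
  have h : ((k : SymFn) + 1) = MvPolynomial.C ((k : ℚ) + 1) := by simp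
  rw [h, ← MvPolynomial.smul_eq_C_mul, smul_smul, mul_inv_cancel₀ (by positivity), one_smul]

/-- The plethysm `e_k ∘ h₂`. -/
noncomputable def eps (k : ℕ) : SymFn := pleth (ee k) (hh 2)

/-- The coefficients `p_i ∘ h₂`, with `0` in degree `0`. -/
noncomputable def qq (i : ℕ) : SymFn := if i = 0 then 0 else adams i (hh 2)

/-- Generating function of the `h_n`. -/
noncomputable def serh : PowerSeries SymFn := PowerSeries.mk fun n : ℕ => hh (n : ℤ)
/-- Generating function of the `p_n`. -/
noncomputable def serp : PowerSeries SymFn := PowerSeries.mk pp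
/-- Generating function of the `(-1)ⁿ e_n`. -/
noncomputable def sere : PowerSeries SymFn := PowerSeries.mk fun n => (-1) ^ n * ee n
/-- Generating function of the `h_n ∘ h₂`. -/
noncomputable def serH : PowerSeries SymFn := PowerSeries.mk (hPleth (hh 2))
/-- Generating function of the `p_n ∘ h₂`. -/
noncomputable def serQ : PowerSeries SymFn := PowerSeries.mk qq
/-- Generating function of the `(-1)ⁿ e_n ∘ h₂`. -/
noncomputable def serE : PowerSeries SymFn := PowerSeries.mk fun n => (-1) ^ n * eps n

lemma pp_zero : pp 0 = 0 := by rw [pp]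

lemma ee_zero : ee 0 = 1 := by rw [ee]

lemma eps_zero : eps 0 = 1 := by rw [eps, ee_zero, pleth, map_one]

lemma euler_serh : euler serh = serp * serh := by
  apply euler_of_rec _ _ pp_zero
  intro n
  rw [← Finset.sum_range_reflect, Finset.sum_range_succ']
  have h0 : pp (n + 1 - 1 - 0 + 1) * hh ((n - (n + 1 - 1 - 0) : ℕ) : ℤ) = pp (n+1) := by
    have e1 : n + 1 - 1 - 0 + 1 = n + 1 := by omega
    have e2 : n - (n + 1 - 1 - 0) = 0 := by omega
    rw [e1, e2]; simp [hh_zero]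
  rw [h0, pp]
  have h1 : ((n : ℚ) + 1) • hh ((n : ℤ) + 1) = ((n : SymFn) + 1) * hh ((n + 1 : ℕ) : ℤ) := by
    rw [MvPolynomial.smul_eq_C_mul]; simp
  rw [h1]
  have h2 : ∑ i ∈ Finset.range n, pp (n + 1 - 1 - (i+1) + 1) * hh ((n - (n + 1 - 1 - (i+1)) : ℕ) : ℤ)
      = ∑ i ∈ Finset.range n, hh ((i : ℤ) + 1) * pp (n - i) := by
    refine Finset.sum_congr rfl fun i hi => ?_
    have hi' : i < n := Finset.mem_range.mp hi
    have e1 : n + 1 - 1 - (i + 1) + 1 = n - i := by omega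
    have e2 : n - (n + 1 - 1 - (i + 1)) = i + 1 := by omega
    rw [e1, e2, mul_comm]; push_cast; rfl
  rw [h2]; ring

lemma euler_serH : euler serH = serQ * serH := by
  apply euler_of_rec _ _ (by simp [qq])
  intro n
  rw [hPleth, smul_cancel_succ]
  refine Finset.sum_congr rfl fun i _ => ?_
  rw [qq, if_neg (Nat.succ_ne_zero i)]

lemma smul_neg_one_pow (i : ℕ) (x : SymFn) : ((-1 : ℚ)) ^ i • x = (-1) ^ i * x := by
  rw [MvPolynomial.smul_eq_C_mul]; simp

lemma serh_mul_sere : serh * sere = 1 := by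
  apply inv_of_rec _ _ (by simp [hh_zero]) ee_zero
  intro n
  rw [ee]
  refine Finset.sum_congr rfl fun i _ => ?_
  rw [smul_neg_one_pow]; push_cast; rfl

lemma serH_mul_serE : serH * serE = 1 := by
  apply inv_of_rec _ _ (by rw [hPleth]) eps_zero
  intro n
  rw [eps, ee, pleth, map_sum]
  refine Finset.sum_congr rfl fun i _ => ?_
  rw [map_smul, smul_neg_one_pow, map_mul, hh_succ, aeval_X]
  rfl

/-- Apply the shift to the coefficients. -/
noncomputable abbrev mE : PowerSeries SymFn →+* PowerSeries (Polynomial SymFn) :=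
  PowerSeries.map (shiftE : SymFn →+* Polynomial SymFn)

/-- Constants. -/
noncomputable abbrev mC : PowerSeries SymFn →+* PowerSeries (Polynomial SymFn) :=
  PowerSeries.map (Polynomial.C : SymFn →+* Polynomial SymFn)

lemma shift_serh :
    mE serh * (1 - PowerSeries.C (Polynomial.X : Polynomial SymFn) * PowerSeries.X) = mC serh := by
  ext1 n
  rw [mul_sub, mul_one, map_sub,
    show mE serh * (PowerSeries.C (Polynomial.X : Polynomial SymFn) * PowerSeries.X)
      = PowerSeries.C Polynomial.X * (mE serh * PowerSeries.X) by ring, PowerSeries.coeff_C_mul]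
  cases n with
  | zero => simp [serh, hh_zero]
  | succ n =>
    rw [PowerSeries.coeff_succ_mul_X]
    simp only [PowerSeries.coeff_map, serh, PowerSeries.coeff_mk]
    have := shiftE_hh_rec ((n + 1 : ℕ) : ℤ)
    have e : ((n + 1 : ℕ) : ℤ) - 1 = n := by push_cast; ring
    rw [e] at this
    change shiftE _ - _ * shiftE _ = _
    rw [this]; ring

lemma shift_serp : mE serp = mC serp + geom Polynomial.X := by
  set T := PowerSeries.C (Polynomial.X : Polynomial SymFn) * PowerSeries.X with hT
  have h1 : euler (mE serh) = mE serp * mE serh := by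
    rw [mE, euler_map, euler_serh, map_mul]
  have h2 : euler (mC serh) = mC serp * mC serh := by
    rw [mC, euler_map, euler_serh, map_mul]
  have h3 := shift_serh
  rw [← hT] at h3
  have h4 := geom_mul (Polynomial.X : Polynomial SymFn)
  rw [← hT] at h4
  have h5 : euler (1 - T) = - T := euler_one_sub _
  rw [← h3, euler_mul, h1, h5] at h2
  have hne : mE serh ≠ 0 := by
    intro h
    have := congrArg (PowerSeries.coeff 0) h
    simp [serh, hh_zero] at this
  have hne2 : (1 - T) ≠ 0 := by
    intro h
    have := congrArg (PowerSeries.coeff 0) h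
    simp [hT] at this
  apply mul_right_cancel₀ hne2
  apply mul_left_cancel₀ hne
  linear_combination h2 - mE serh * h4

lemma shiftE_pp (n : ℕ) (hn : n ≠ 0) :
    shiftE (pp n) = Polynomial.C (pp n) + Polynomial.X ^ n := by
  have := congrArg (PowerSeries.coeff n) shift_serp
  simpa [serp, geom, hn] using this

lemma two_mul_qq (i : ℕ) (hi : i ≠ 0) : 2 * qq i = pp i ^ 2 + pp (2 * i) := by
  have h2 : hh 2 = MvPolynomial.X 1 := hh_succ 1
  have hp1 : hInP 1 = MvPolynomial.X 0 := by
    rw [hInP]; simp [hInP]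
  have hp2 : 2 * hInP 2 = MvPolynomial.X 0 ^ 2 + MvPolynomial.X 1 := by
    have := smul_cancel_succ 1
      (∑ i ∈ Finset.range (1+1), MvPolynomial.X i * hInP (1 - i))
    rw [hInP]
    have e : ((1 : ℕ) : SymFn) + 1 = 2 := by norm_num
    rw [e] at this
    rw [this, Finset.sum_range_succ, Finset.sum_range_one]
    simp [hp1, hInP]; ring
  rw [qq, if_neg hi, h2, adams, aeval_X]
  have := congrArg (aeval (fun j => pp (i * (j+1))) : MvPolynomial ℕ ℚ →ₐ[ℚ] SymFn) hp2
  rw [map_mul, map_add, map_pow, aeval_X, aeval_X, map_ofNat] at this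
  rw [show (1 + 1 : ℕ) = 2 from rfl, this]
  ring_nf

lemma shiftE_qq (i : ℕ) (hi : i ≠ 0) :
    shiftE (qq i) = Polynomial.C (qq i) + Polynomial.X ^ i * Polynomial.C (pp i)
      + (Polynomial.X ^ 2) ^ i := by
  have h := two_mul_qq i hi
  have h1 := congrArg shiftE h
  have h2 := congrArg (Polynomial.C : SymFn →+* Polynomial SymFn) h
  rw [map_mul, map_add, map_pow, map_ofNat, shiftE_pp i hi, shiftE_pp (2 * i) (by omega)] at h1
  rw [map_mul, map_add, map_pow, map_ofNat] at h2
  have h3 : (2 : Polynomial SymFn) ≠ 0 := two_ne_zero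
  apply mul_left_cancel₀ h3
  rw [h1]
  rw [← pow_mul]
  linear_combination -h2

lemma shift_serQ : mE serQ = mC serQ + PowerSeries.rescale Polynomial.X (mC serp)
    + geom (Polynomial.X ^ 2) := by
  ext1 n
  by_cases hn : n = 0
  · subst hn
    simp only [map_add, PowerSeries.coeff_map, PowerSeries.coeff_rescale, PowerSeries.coeff_mk,
      serQ, serp, qq, pp_zero, geom, if_true, map_zero, mul_zero, add_zero]
  · have := shiftE_qq n hn
    simpa [serQ, serp, geom, hn] using this

lemma shift_serH : mE serH *
    (1 - PowerSeries.C (Polynomial.X ^ 2 : Polynomial SymFn) * PowerSeries.X)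
      = mC serH * PowerSeries.rescale Polynomial.X (mC serh) := by
  apply euler_unique (mC serQ + PowerSeries.rescale Polynomial.X (mC serp))
  · simp only [map_add, PowerSeries.coeff_map, PowerSeries.coeff_rescale, PowerSeries.coeff_mk,
      serQ, serp, qq, pp_zero, if_true, map_zero, mul_zero, add_zero]
  · have h1 : euler (mE serH) = mE serQ * mE serH := by
      rw [mE, euler_map, euler_serH, map_mul]
    rw [euler_mul, h1, euler_one_sub, shift_serQ]
    linear_combination mE serH * geom_mul (Polynomial.X ^ 2 : Polynomial SymFn)
  · have h1 : euler (mC serH) = mC serQ * mC serH := by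
      rw [mC, euler_map, euler_serH, map_mul]
    have h2 : euler (mC serh) = mC serp * mC serh := by
      rw [mC, euler_map, euler_serh, map_mul]
    rw [euler_mul, h1, euler_rescale, h2, map_mul]
    ring
  · rw [PowerSeries.coeff_mul, PowerSeries.coeff_mul]
    have h0 : hPleth (hh 2) 0 = 1 := by rw [hPleth]
    simp [PowerSeries.coeff_map, PowerSeries.coeff_rescale, PowerSeries.coeff_mk, serH, serh,
      -PowerSeries.coeff_zero_eq_constantCoeff, h0, hh_zero]
    simp

lemma shift_serE : mE serE = mC serE * PowerSeries.rescale Polynomial.X (mC sere) *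
    (1 - PowerSeries.C (Polynomial.X ^ 2 : Polynomial SymFn) * PowerSeries.X) := by
  have h1 : mE serH * mE serE = 1 := by rw [← map_mul, serH_mul_serE, map_one]
  have h2 : mC serH * mC serE = 1 := by rw [← map_mul, serH_mul_serE, map_one]
  have h3 : PowerSeries.rescale Polynomial.X (mC serh) *
      PowerSeries.rescale (Polynomial.X : Polynomial SymFn) (mC sere) = 1 := by
    rw [← map_mul, ← map_mul, serh_mul_sere, map_one, map_one]
  have h4 := shift_serH
  set Y := (1 - PowerSeries.C (Polynomial.X ^ 2 : Polynomial SymFn) * PowerSeries.X)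
  set a := mE serH
  set b := mE serE
  set c := mC serH
  set d := mC serE
  set x := PowerSeries.rescale Polynomial.X (mC serh)
  set y := PowerSeries.rescale (Polynomial.X : Polynomial SymFn) (mC sere)
  linear_combination (d * y * Y) * h1 - b * d * y * h4 - b * (x * y) * h2 - b * h3

lemma coeff_prod (m : ℕ) : PowerSeries.coeff m
      (mC serE * PowerSeries.rescale (Polynomial.X : Polynomial SymFn) (mC sere))
    = (-1) ^ m * ∑ p ∈ Finset.HasAntidiagonal.antidiagonal m,
        Polynomial.C (eps p.1 * ee p.2) * Polynomial.X ^ p.2 := by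
  rw [PowerSeries.coeff_mul, Finset.mul_sum]
  refine Finset.sum_congr rfl fun p hp => ?_
  rw [Finset.HasAntidiagonal.mem_antidiagonal] at hp
  rw [← hp, pow_add]
  simp only [PowerSeries.coeff_map, PowerSeries.coeff_rescale, serE, sere, PowerSeries.coeff_mk,
    map_mul, map_pow, map_neg, map_one]
  ring

lemma shiftE_eps (k : ℕ) : shiftE (eps (k+1))
    = ∑ p ∈ Finset.HasAntidiagonal.antidiagonal (k+1), Polynomial.C (eps p.1 * ee p.2) * Polynomial.X ^ p.2
    + ∑ p ∈ Finset.HasAntidiagonal.antidiagonal k,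
        Polynomial.C (eps p.1 * ee p.2) * Polynomial.X ^ (p.2 + 2) := by
  have h := congrArg (PowerSeries.coeff (k+1)) shift_serE
  set W := mC serE * PowerSeries.rescale (Polynomial.X : Polynomial SymFn) (mC sere) with hW
  rw [mul_sub, mul_one, map_sub,
    show W * (PowerSeries.C (Polynomial.X ^ 2 : Polynomial SymFn) * PowerSeries.X)
      = PowerSeries.C (Polynomial.X ^ 2) * (W * PowerSeries.X) by ring, PowerSeries.coeff_C_mul,
    PowerSeries.coeff_succ_mul_X, hW, coeff_prod, coeff_prod] at h
  have h1 : PowerSeries.coeff (k+1) (mE serE) = (-1) ^ (k+1) * shiftE (eps (k+1)) := by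
    simp [serE]
  rw [h1] at h
  have h2 : ((-1 : Polynomial SymFn)) ^ (k+1) ≠ 0 := pow_ne_zero _ (by simp)
  apply mul_left_cancel₀ h2
  rw [h, mul_add, sub_eq_add_neg]
  congr 1
  simp only [pow_add, ← mul_assoc, ← Finset.sum_mul]
  ring

lemma coeff_eps_gt (k j : ℕ) (hj : k + 2 < j) : (shiftE (eps (k+1))).coeff j = 0 := by
  rw [shiftE_eps, Polynomial.coeff_add, Polynomial.finsetSum_coeff, Polynomial.finsetSum_coeff,
    Finset.sum_eq_zero, Finset.sum_eq_zero, add_zero]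
  all_goals
    intro p hp
    rw [Finset.HasAntidiagonal.mem_antidiagonal] at hp
    rw [Polynomial.coeff_C_mul_X_pow, if_neg (by omega)]

lemma coeff_eps_eq (k : ℕ) : (shiftE (eps (k+1))).coeff (k+2) = ee k := by
  rw [shiftE_eps, Polynomial.coeff_add, Polynomial.finsetSum_coeff, Polynomial.finsetSum_coeff,
    Finset.sum_eq_zero, zero_add, Finset.sum_eq_single (0, k)]
  · rw [Polynomial.coeff_C_mul_X_pow, if_pos rfl, eps_zero, one_mul]
  · intro p hp hne
    rw [Finset.HasAntidiagonal.mem_antidiagonal] at hp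
    rw [Polynomial.coeff_C_mul_X_pow, if_neg]
    intro h
    apply hne
    ext <;> simp <;> omega
  · intro h; simp at h
  · intro p hp
    rw [Finset.HasAntidiagonal.mem_antidiagonal] at hp
    rw [Polynomial.coeff_C_mul_X_pow, if_neg (by omega)]

lemma ee_ne_zero (k : ℕ) : ee k ≠ 0 := by
  have h : (aeval (fun n : ℕ => if n = 0 then (1 : ℚ) else 0) : SymFn →ₐ[ℚ] ℚ) (ee k) = 1 := by
    induction k with
    | zero => rw [ee_zero, map_one]
    | succ k ih =>
      rw [ee, map_sum, Finset.sum_range_succ', Finset.sum_eq_zero, zero_add, map_smul, map_mul,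
        hh_succ, aeval_X, Nat.sub_zero, ih]
      · simp
      · intro i _
        rw [map_smul, map_mul, hh_succ, aeval_X, if_neg (Nat.succ_ne_zero i), zero_mul, smul_zero]
  intro h0
  rw [h0, map_zero] at h
  exact zero_ne_one h

/-- `Φ(e_k ∘ h₂) = k + 1` for every `k ≥ 1`. -/
theorem phi_ek_pleth_h2 (k : ℕ) (hk : 1 ≤ k)
    (c : Multiset ℕ →₀ ℚ) (hc : SchurExpansion (pleth (ee k) (hh 2)) c) :
    Phi c = k + 1 := by
  obtain ⟨n, rfl⟩ : ∃ n, k = n + 1 := ⟨k - 1, by omega⟩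
  apply phi_of_shift _ c hc
  · change (shiftE (eps (n+1))).coeff (n + 2) ≠ 0
    rw [coeff_eps_eq]; exact ee_ne_zero n
  · intro j hj
    exact coeff_eps_gt n j hj
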